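/- arXiv:1608.06372 — 2 statements merged into one kernel-verified Lean document; each statement's English description precedes it below -/
import Mathlib

section
/- The sequence (dim(K[X_n]/I_n))/n of Krull dimensions divided by n converges as n → ∞, and lim_{n→∞} dim(K[X_n]/I_n)/n = c − 1. -/
open MvPolynomial

noncomputable section

/-- The monomial `x^a = ∏_{i} ∏_{1 ≤ j ≤ μ_r} x_{i,j}^{a_{i,j}}` in
`K[X] = K[x_{i,j} : 1 ≤ i ≤ c, j ≥ 1]` (column indices in `ℕ`, only indices `≥ 1` occur). -/
def orbMonC (K : Type*) [Field K] (c r : ℕ) (μ : ℕ → ℕ) (a : Fin c → ℕ → ℕ) :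
    MvPolynomial (Fin c × ℕ) K :=
  ∏ i : Fin c, ∏ j ∈ Finset.Icc 1 (μ (r - 1)),
    (X (i, j) : MvPolynomial (Fin c × ℕ) K) ^ a i j

/-- The ideal generated by the `Inc`-orbit of a polynomial, the monoid `Inc` of strictly
increasing maps acting by `π · x_{i,j} = x_{i,π(j)}`. -/
def orbitIdealC (K : Type*) [Field K] {c : ℕ} (m : MvPolynomial (Fin c × ℕ) K) :
    Ideal (MvPolynomial (Fin c × ℕ) K) :=
  Ideal.span {q | ∃ π : ℕ → ℕ, StrictMono π ∧ q = rename (fun p => (p.1, π p.2)) m}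

/-- Index type for the columns `1, …, n` of `K[X_n]`. -/
abbrev ColIdx (n : ℕ) := {j : ℕ // j ∈ Finset.Icc 1 n}

/-- The inclusion `K[X_n] → K[X]`. -/
def toBigC (K : Type*) [Field K] (c n : ℕ) :
    MvPolynomial (Fin c × ColIdx n) K →ₐ[K] MvPolynomial (Fin c × ℕ) K :=
  rename fun p => (p.1, p.2.1)

/-- `I_n = I ∩ K[X_n]`, realized as an ideal of `K[X_n]` (this is legitimate because
`toBigC` is injective). -/
def restrC (K : Type*) [Field K] {c : ℕ} (I : Ideal (MvPolynomial (Fin c × ℕ) K)) (n : ℕ) :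
    Ideal (MvPolynomial (Fin c × ColIdx n) K) :=
  Ideal.comap (toBigC K c n) I

/-- The inclusion `K[X_m] → K[X_n]` for `m ≤ n`. -/
def inclC (K : Type*) [Field K] (c : ℕ) {m n : ℕ} (h : m ≤ n) :
    MvPolynomial (Fin c × ColIdx m) K →ₐ[K] MvPolynomial (Fin c × ColIdx n) K :=
  rename fun p => (p.1, ⟨p.2.1, Finset.Icc_subset_Icc le_rfl h p.2.2⟩)

/-- The dimension of the degree `j` component of `K[X_n]/I`, for a homogeneous ideal `I`:
the `K`-dimension of (homogeneous polynomials of degree `j`) modulo (those lying in `I`). -/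
def hilbF (K : Type*) [Field K] {σ : Type*} (I : Ideal (MvPolynomial σ K)) (j : ℕ) : ℕ :=
  Module.finrank K
    (↥(homogeneousSubmodule σ K j) ⧸
      (Submodule.comap (homogeneousSubmodule σ K j).subtype (Submodule.restrictScalars K I)))

/-- The Hilbert series of `K[X_n]/I` as a power series in `ℤ[[t]]`. -/
def hseries (K : Type*) [Field K] {σ : Type*} (I : Ideal (MvPolynomial σ K)) :
    PowerSeries ℤ :=
  PowerSeries.mk fun j => (hilbF K I j : ℤ)

end

/-- A bound on the dimensions of the quotients by all primes over `I` bounds the dimension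
of the quotient by `I`. -/
lemma ringKrullDim_quotient_le_of_forall_isPrime {R : Type*} [CommRing R] (I : Ideal R)
    (d : WithBot ℕ∞)
    (h : ∀ P : Ideal R, P.IsPrime → I ≤ P → ringKrullDim (R ⧸ P) ≤ d) :
    ringKrullDim (R ⧸ I) ≤ d := by
  rw [ringKrullDim_quotient]
  refine iSup_le fun l => ?_
  have hI : I ≤ l.head.1.asIdeal := l.head.2
  refine le_trans ?_ (h l.head.1.asIdeal l.head.1.isPrime hI)
  rw [ringKrullDim_quotient]
  let l' : LTSeries (PrimeSpectrum.zeroLocus (l.head.1.asIdeal : Set R)) :=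
    { length := l.length
      toFun := fun k => ⟨(l k).1, LTSeries.head_le l k⟩
      step := fun k => l.step k }
  exact Order.LTSeries.length_le_krullDim l'

lemma MvPolynomial.ringKrullDim_field {K σ : Type*} [Field K] [Finite σ] :
    ringKrullDim (MvPolynomial σ K) = (Nat.card σ : WithBot ℕ∞) := by
  rw [MvPolynomial.ringKrullDim_of_isNoetherianRing, ringKrullDim_eq_zero_of_field, zero_add]

/-- An ideal containing the variables in `S` has quotient of dimension at most the number of
remaining variables. -/
lemma MvPolynomial.ringKrullDim_quotient_le_of_X_mem {K σ : Type*} [Field K] [Finite σ]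
    (S : Set σ) (P : Ideal (MvPolynomial σ K)) (hS : ∀ s ∈ S, (X s : MvPolynomial σ K) ∈ P) :
    ringKrullDim (MvPolynomial σ K ⧸ P) ≤ (Nat.card {s // s ∉ S} : WithBot ℕ∞) := by
  rw [← MvPolynomial.ringKrullDim_field (K := K)]
  refine ringKrullDim_le_of_surjective
    ((Ideal.Quotient.mk P).comp
      (rename (Subtype.val : {s // s ∉ S} → σ) : _ →ₐ[K] MvPolynomial σ K).toRingHom) fun q => ?_
  obtain ⟨f, rfl⟩ := Ideal.Quotient.mk_surjective q
  induction f using MvPolynomial.induction_on with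
  | C k => exact ⟨C k, by simp⟩
  | add f g hf hg =>
    obtain ⟨u, hu⟩ := hf
    obtain ⟨v, hv⟩ := hg
    exact ⟨u + v, by rw [map_add, hu, hv, map_add]⟩
  | mul_X f s hf =>
    obtain ⟨u, hu⟩ := hf
    by_cases hs : s ∈ S
    · exact ⟨0, by rw [map_zero, map_mul, Ideal.Quotient.eq_zero_iff_mem.2 (hS s hs), mul_zero]⟩
    · exact ⟨u * X ⟨s, hs⟩, by rw [map_mul, hu, map_mul]; simp⟩

/-- A surjection onto a polynomial ring that kills `I` bounds the dimension of the quotient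
by `I` from below. -/
lemma MvPolynomial.card_le_ringKrullDim_quotient {K τ R : Type*} [Field K] [Finite τ]
    [CommRing R] (I : Ideal R) (φ : R →+* MvPolynomial τ K) (hφ : Function.Surjective φ)
    (hI : ∀ f ∈ I, φ f = 0) : (Nat.card τ : WithBot ℕ∞) ≤ ringKrullDim (R ⧸ I) := by
  rw [← MvPolynomial.ringKrullDim_field (K := K)]
  exact ringKrullDim_le_of_surjective (Ideal.Quotient.lift I φ hI)
    (Ideal.Quotient.lift_surjective_of_surjective I hI hφ)

/-- Any `M` positive integers contain the image of `{1, …, M}` under a strictly increasing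
map of `ℕ`. -/
lemma Nat.exists_strictMono_mapsTo_Icc (B : Finset ℕ) (h0 : 0 ∉ B) (M : ℕ) (hM : M ≤ B.card) :
    ∃ π : ℕ → ℕ, StrictMono π ∧ ∀ j ∈ Finset.Icc 1 M, π j ∈ B := by
  classical
  obtain ⟨n, hn⟩ := B.bddAbove
  let p : ℕ → Prop := fun j => j = 0 ∨ j ∈ B ∨ n < j
  have hp : (Set.ofPred p).Infinite :=
    (Set.Ioi_infinite n).mono fun j hj => Or.inr (Or.inr hj)
  refine ⟨Nat.nth p, Nat.nth_strictMono hp, fun j hj => ?_⟩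
  rw [Finset.mem_Icc] at hj
  have hcount : B.card + 1 ≤ Nat.count p (n + 1) := by
    rw [Nat.count_eq_card_filter_range, ← Finset.card_insert_of_notMem h0]
    refine Finset.card_le_card fun x hx => ?_
    rw [Finset.mem_filter, Finset.mem_range]
    rcases Finset.mem_insert.1 hx with rfl | hx
    · exact ⟨n.succ_pos, Or.inl rfl⟩
    · exact ⟨Nat.lt_succ_of_le (hn hx), Or.inr (Or.inl hx)⟩
  have hlt : Nat.nth p j < n + 1 := Nat.nth_lt_of_lt_count (by omega)
  have hpos : Nat.nth p 0 < Nat.nth p j := Nat.nth_strictMono hp (by omega)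
  rcases Nat.nth_mem_of_infinite hp j with h | h | h
  · omega
  · exact h
  · omega

lemma rename_orbMonC_mem_orbitIdealC (K : Type*) [Field K] {c r : ℕ} {μ : ℕ → ℕ}
    {a : Fin c → ℕ → ℕ} {π : ℕ → ℕ} (hπ : StrictMono π) :
    (∏ i : Fin c, ∏ j ∈ Finset.Icc 1 (μ (r - 1)),
      (X (i, π j) : MvPolynomial (Fin c × ℕ) K) ^ a i j) ∈
        orbitIdealC K (orbMonC K c r μ a) :=
  Ideal.subset_span ⟨π, hπ, by simp [orbMonC, map_prod]⟩

/-- A prime over `I_n` contains a variable from all but at most `μ_r` of the columns. -/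
lemma le_card_X_mem_add {K : Type*} [Field K] {c r : ℕ} {μ : ℕ → ℕ} {a : Fin c → ℕ → ℕ} {n : ℕ}
    (P : Ideal (MvPolynomial (Fin c × ColIdx n) K)) (hP : P.IsPrime)
    (hI : restrC K (orbitIdealC K (orbMonC K c r μ a)) n ≤ P) :
    n ≤ Nat.card {p : Fin c × ColIdx n // (X p : MvPolynomial (Fin c × ColIdx n) K) ∈ P} +
      μ (r - 1) := by
  classical
  let B : Finset (ColIdx n) :=
    Finset.univ.filter fun j => ∀ i, (X (i, j) : MvPolynomial (Fin c × ColIdx n) K) ∉ P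
  have hB : B.card ≤ μ (r - 1) := by
    by_contra! hlt
    obtain ⟨π, hπ, hmem⟩ := Nat.exists_strictMono_mapsTo_Icc
      (B.map (Function.Embedding.subtype _)) (by simp) (μ (r - 1)) (by
        rw [Finset.card_map]; exact hlt.le)
    have hmem' : ∀ j ∈ Finset.Icc 1 (μ (r - 1)), ∃ b ∈ B, b.1 = π j := fun j hj =>
      Finset.mem_map.1 (hmem j hj)
    choose b hbB hb using hmem'
    have hin : (∏ i : Fin c, ∏ j ∈ (Finset.Icc 1 (μ (r - 1))).attach,
        (X (i, b j.1 j.2) : MvPolynomial (Fin c × ColIdx n) K) ^ a i j) ∈ P := by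
      refine hI ?_
      rw [restrC, Ideal.mem_comap]
      convert rename_orbMonC_mem_orbitIdealC K (r := r) (μ := μ) (a := a) hπ using 1
      simp only [toBigC, map_prod, map_pow, rename_X]
      refine Finset.prod_congr rfl fun i _ => ?_
      rw [← Finset.prod_attach (Finset.Icc 1 (μ (r - 1)))]
      exact Finset.prod_congr rfl fun j _ => by rw [hb j.1 j.2]
    obtain ⟨i, -, hi⟩ := Ideal.IsPrime.prod_mem_iff.1 hin
    obtain ⟨j, -, hj⟩ := Ideal.IsPrime.prod_mem_iff.1 hi
    exact (Finset.mem_filter.1 (hbB j.1 j.2)).2 i (hP.mem_of_pow_mem _ hj)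
  have hcompl : Bᶜ.card ≤
      (Finset.univ.filter fun p : Fin c × ColIdx n =>
        (X p : MvPolynomial (Fin c × ColIdx n) K) ∈ P).card := by
    refine (Finset.card_le_card fun j hj => ?_).trans (Finset.card_image_le (f := Prod.snd))
    have : ∃ i, (X (i, j) : MvPolynomial (Fin c × ColIdx n) K) ∈ P := by
      simpa [B] using hj
    obtain ⟨i, hi⟩ := this
    exact Finset.mem_image.2 ⟨(i, j), by simpa using hi, rfl⟩
  rw [Nat.card_eq_fintype_card, Fintype.card_subtype]
  have hcard : Fintype.card (ColIdx n) = n := by simp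
  have := Finset.card_compl B
  omega

/-- If the monomial involves row `i₀`, the polynomial ring in the other rows is a quotient of
`K[X_n]/I_n`. -/
lemma card_le_ringKrullDim_restrC {K : Type*} [Field K] {c r : ℕ} {μ : ℕ → ℕ}
    {a : Fin c → ℕ → ℕ} (i₀ : Fin c) (j₀ : ℕ) (hj₀ : j₀ ∈ Finset.Icc 1 (μ (r - 1)))
    (ha : a i₀ j₀ ≠ 0) (n : ℕ) :
    (((c - 1) * n : ℕ) : WithBot ℕ∞) ≤ ringKrullDim
      (MvPolynomial (Fin c × ColIdx n) K ⧸ restrC K (orbitIdealC K (orbMonC K c r μ a)) n) := by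
  classical
  let ψ : MvPolynomial (Fin c × ℕ) K →ₐ[K] MvPolynomial ({i : Fin c // i ≠ i₀} × ColIdx n) K :=
    aeval fun p => if h : p.1 ≠ i₀ ∧ p.2 ∈ Finset.Icc 1 n then X (⟨p.1, h.1⟩, ⟨p.2, h.2⟩) else 0
  have hψ : ∀ f ∈ orbitIdealC K (orbMonC K c r μ a), ψ f = 0 := by
    refine fun f hf => Ideal.span_le (I := RingHom.ker ψ).2 ?_ hf
    rintro _ ⟨π, -, rfl⟩
    rw [SetLike.mem_coe, RingHom.mem_ker, orbMonC, map_prod, map_prod]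
    refine Finset.prod_eq_zero (Finset.mem_univ i₀) ?_
    rw [map_prod, map_prod]
    refine Finset.prod_eq_zero hj₀ ?_
    simp [ψ, ha]
  have hcard : Nat.card ({i : Fin c // i ≠ i₀} × ColIdx n) = (c - 1) * n := by
    simp [Nat.card_eq_fintype_card, Fintype.card_subtype_compl]
  rw [← hcard]
  refine MvPolynomial.card_le_ringKrullDim_quotient _ (ψ.comp (toBigC K c n)).toRingHom
    (fun g => ⟨rename (fun p => (p.1.1, p.2)) g, ?_⟩) fun f hf => hψ _ hf
  change ψ (toBigC K c n (rename _ g)) = g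
  induction g using MvPolynomial.induction_on with
  | C k => simp
  | add f g hf hg => simp only [map_add, hf, hg]
  | mul_X f s hf =>
    rw [map_mul, map_mul, map_mul, hf]
    congr 1
    have h1 : s.1.1 ≠ i₀ := s.1.2
    have h2 : 1 ≤ s.2.1 ∧ s.2.1 ≤ n := Finset.mem_Icc.1 s.2.2
    simp [toBigC, ψ, h1, h2]

/-- The sequence `dim(K[X_n]/I_n)/n` of Krull dimensions divided by `n`
converges to `c - 1` as `n → ∞`. -/
theorem statement18 (K : Type*) [Field K] (c : ℕ) (hc : 1 ≤ c) (r : ℕ) (hr : 1 ≤ r)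
    (μ : ℕ → ℕ) (hμ1 : 1 ≤ μ 0) (hμ : ∀ j, j + 1 < r → μ j < μ (j + 1))
    (a : Fin c → ℕ → ℕ) (hcols : ∀ j : ℕ, (∃ i, a i j ≠ 0) ↔ ∃ k, k < r ∧ j = μ k)
    (D : ℕ → ℕ)
    (hD : ∀ n, (D n : WithBot (WithTop ℕ)) =
      ringKrullDim
        (MvPolynomial (Fin c × ColIdx n) K ⧸ restrC K (orbitIdealC K (orbMonC K c r μ a)) n)) :
    Filter.Tendsto (fun n : ℕ => (D n : ℝ) / (n : ℝ)) Filter.atTop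
      (nhds ((c : ℝ) - 1)) := by
  have hμmono : ∀ k, k < r → μ 0 ≤ μ k := by
    intro k
    induction k with
    | zero => exact fun _ => le_rfl
    | succ k ih => exact fun h => (ih (by omega)).trans (hμ k h).le
  obtain ⟨i₀, ha⟩ := (hcols (μ 0)).2 ⟨0, hr, rfl⟩
  have hlow : ∀ n, (c - 1) * n ≤ D n := fun n => by
    have h := card_le_ringKrullDim_restrC (K := K) (r := r) (μ := μ) i₀ (μ 0)
      (Finset.mem_Icc.2 ⟨hμ1, hμmono (r - 1) (by omega)⟩) ha n
    rw [← hD n] at h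
    exact (Nat.cast_le (α := WithBot ℕ∞)).1 h
  have hupp : ∀ n, D n ≤ (c - 1) * n + μ (r - 1) := fun n => by
    have h := ringKrullDim_quotient_le_of_forall_isPrime
      (restrC K (orbitIdealC K (orbMonC K c r μ a)) n)
      (((c - 1) * n + μ (r - 1) : ℕ) : WithBot ℕ∞) fun P hP hI => by
        refine (MvPolynomial.ringKrullDim_quotient_le_of_X_mem {p | X p ∈ P} P
          fun _ h => h).trans ?_
        have hle := le_card_X_mem_add P hP hI
        have hsum : Nat.card {p : Fin c × ColIdx n // X p ∈ P} +
            Nat.card {p : Fin c × ColIdx n // p ∉ {p | X p ∈ P}} = c * n := by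
          classical
          have := Fintype.card_subtype_compl (fun p : Fin c × ColIdx n => X p ∈ P)
          have h2 := Fintype.card_subtype_le (fun p : Fin c × ColIdx n => X p ∈ P)
          have h3 : Fintype.card (Fin c × ColIdx n) = c * n := by simp
          simp only [Nat.card_eq_fintype_card, Set.mem_ofPred_eq]
          omega
        obtain ⟨d, rfl⟩ := Nat.exists_eq_add_of_le' hc
        rw [add_mul, one_mul] at hsum
        have : Nat.card {p : Fin (d + 1) × ColIdx n // p ∉ {p | X p ∈ P}} ≤
            (d + 1 - 1) * n + μ (r - 1) := by
          rw [Nat.add_sub_cancel]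
          omega
        exact_mod_cast this
    rw [← hD n] at h
    exact (Nat.cast_le (α := WithBot ℕ∞)).1 h
  have hlim : Filter.Tendsto (fun n : ℕ => ((c : ℝ) - 1) + (μ (r - 1) : ℝ) / (n : ℝ))
      Filter.atTop (nhds ((c : ℝ) - 1)) := by
    simpa using (tendsto_const_div_atTop_nhds_zero_nat (μ (r - 1) : ℝ)).const_add ((c : ℝ) - 1)
  have hc' : ((c - 1 : ℕ) : ℝ) = (c : ℝ) - 1 := by push_cast [hc]; ring
  refine tendsto_of_tendsto_of_tendsto_of_le_of_le' tendsto_const_nhds hlim ?_ ?_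
  · filter_upwards [Filter.eventually_gt_atTop 0] with n hn
    rw [le_div_iff₀ (by exact_mod_cast hn), ← hc']
    exact_mod_cast hlow n
  · filter_upwards [Filter.eventually_gt_atTop 0] with n hn
    have hn' : (0 : ℝ) < n := by exact_mod_cast hn
    rw [div_le_iff₀ hn', add_mul, div_mul_cancel₀ _ hn'.ne', ← hc']
    exact_mod_cast hupp n
end

section
/- Set b_j = Σ_{i=1}^{c} a_{i,μ_j} for j = 1, …, r. The sequence of real numbers (deg I_n)^{1/n} converges as n → ∞, and lim_{n→∞} (deg I_n)^{1/n} = max{b_1, …, b_r}. -/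
open MvPolynomial

section Counting

variable {σ : Type*}

/-- The truth of `p` at an exponent vector is determined by its entries in `U`. -/
def DeterminedOn (U : Finset σ) (p : (σ →₀ ℕ) → Prop) : Prop :=
  ∀ d d' : σ →₀ ℕ, (∀ x ∈ U, d x = d' x) → (p d ↔ p d')

lemma DeterminedOn.not {U : Finset σ} {p : (σ →₀ ℕ) → Prop} (hp : DeterminedOn U p) :
    DeterminedOn U fun d => ¬ p d :=
  fun d d' h => not_congr (hp d d' h)

lemma DeterminedOn.mono {U V : Finset σ} (hUV : U ⊆ V) {p : (σ →₀ ℕ) → Prop}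
    (hp : DeterminedOn U p) : DeterminedOn V p :=
  fun d d' h => hp d d' fun x hx => h x (hUV hx)

lemma determinedOn_true (U : Finset σ) : DeterminedOn U fun _ => True :=
  fun _ _ _ => Iff.rfl

variable [DecidableEq σ]

open Classical in
/-- The generating function, by total degree, of the exponent vectors supported on `U` that
satisfy `p`. -/
noncomputable def countSeries (U : Finset σ) (p : (σ →₀ ℕ) → Prop) : PowerSeries ℤ :=
  PowerSeries.mk fun j => (((U.finsuppAntidiag j).filter p).card : ℤ)

lemma countSeries_congr {U : Finset σ} {p q : (σ →₀ ℕ) → Prop}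
    (h : ∀ d : σ →₀ ℕ, d.support ⊆ U → (p d ↔ q d)) : countSeries U p = countSeries U q := by
  classical
  ext j
  simp only [countSeries, PowerSeries.coeff_mk, Nat.cast_inj]
  congr 1
  refine Finset.filter_congr fun d hd => h d (Finset.mem_finsuppAntidiag.1 hd).2

lemma countSeries_false (U : Finset σ) : countSeries U (fun _ => False) = 0 := by
  ext j
  simp [countSeries]

lemma countSeries_or {U : Finset σ} {p q : (σ →₀ ℕ) → Prop} (h : ∀ d, p d → ¬ q d) :
    countSeries U (fun d => p d ∨ q d) = countSeries U p + countSeries U q := by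
  classical
  ext j
  simp only [countSeries, PowerSeries.coeff_mk, map_add]
  norm_cast
  rw [← Finset.card_union_of_disjoint, ← Finset.filter_or]
  · congr
  · exact Finset.disjoint_filter.2 fun d _ hd => h d hd

lemma countSeries_not (U : Finset σ) (p : (σ →₀ ℕ) → Prop) :
    countSeries U (fun d => ¬ p d) = countSeries U (fun _ => True) - countSeries U p := by
  rw [eq_sub_iff_add_eq', ← countSeries_or fun d hd hn => hn hd]
  exact countSeries_congr fun d _ => by tauto

lemma countSeries_union {U V : Finset σ} (hUV : Disjoint U V) {p q : (σ →₀ ℕ) → Prop}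
    (hp : DeterminedOn U p) (hq : DeterminedOn V q) :
    countSeries (U ∪ V) (fun d => p d ∧ q d) = countSeries U p * countSeries V q := by
  classical
  have key : ∀ x y : σ →₀ ℕ, x.support ⊆ U → y.support ⊆ V →
      (∀ i ∈ U, (x + y) i = x i) ∧ (∀ i ∈ V, (x + y) i = y i) := by
    intro x y hx hy
    constructor
    · intro i hi
      have : y i = 0 := Finsupp.notMem_support_iff.1
        fun h => Finset.disjoint_left.1 hUV hi (hy h)
      simp [this]
    · intro i hi
      have : x i = 0 := Finsupp.notMem_support_iff.1
        fun h => Finset.disjoint_left.1 hUV (hx h) hi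
      simp [this]
  have hfil : ∀ (W : Finset σ) (d : σ →₀ ℕ), ∀ i ∈ W, d.filter (· ∈ W) i = d i := by
    intro W d i hi
    exact Finsupp.filter_apply_pos _ _ hi
  have hsub : ∀ (W : Finset σ) (d : σ →₀ ℕ), (d.filter (· ∈ W)).support ⊆ W := by
    intro W d i hi
    rw [Finsupp.support_filter, Finset.mem_filter] at hi
    exact hi.2
  ext j
  rw [PowerSeries.coeff_mul]
  simp only [countSeries, PowerSeries.coeff_mk]
  norm_cast
  simp only [← Finset.card_product]
  rw [← Finset.card_sigma]
  refine Finset.card_nbij'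
    (fun d => ⟨(U.sum d, V.sum d), (d.filter (· ∈ U), d.filter (· ∈ V))⟩)
    (fun z => z.2.1 + z.2.2) ?_ ?_ ?_ ?_
  · intro d hd
    simp only [Finset.coe_filter, Finset.mem_finsuppAntidiag, Set.mem_ofPred_eq] at hd
    obtain ⟨⟨hs, hsupp⟩, hpd, hqd⟩ := hd
    simp only [Finset.coe_sigma, Set.mem_sigma_iff, Finset.mem_coe,
      Finset.HasAntidiagonal.mem_antidiagonal, Finset.mem_product, Finset.mem_filter, Finset.mem_finsuppAntidiag]
    refine ⟨?_, ⟨⟨Finset.sum_congr rfl (hfil U d), hsub U d⟩, ?_⟩,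
      ⟨Finset.sum_congr rfl (hfil V d), hsub V d⟩, ?_⟩
    · rw [← Finset.sum_union hUV, hs]
    · exact (hp _ _ (hfil U d)).2 hpd
    · exact (hq _ _ (hfil V d)).2 hqd
  · rintro ⟨⟨m, n⟩, x, y⟩ hz
    simp only [Finset.coe_sigma, Set.mem_sigma_iff, Finset.mem_coe,
      Finset.HasAntidiagonal.mem_antidiagonal, Finset.mem_product, Finset.mem_filter,
      Finset.mem_finsuppAntidiag] at hz
    obtain ⟨hmn, ⟨⟨hxs, hx⟩, hpx⟩, ⟨hys, hy⟩, hqy⟩ := hz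
    obtain ⟨hU, hV⟩ := key x y hx hy
    simp only [Finset.coe_filter, Finset.mem_finsuppAntidiag, Set.mem_ofPred_eq]
    refine ⟨⟨?_, ?_⟩, (hp _ _ hU).2 hpx, (hq _ _ hV).2 hqy⟩
    · rw [Finset.sum_union hUV, Finset.sum_congr rfl hU, Finset.sum_congr rfl hV, hxs, hys, hmn]
    · exact Finsupp.support_add.trans (Finset.union_subset_union hx hy)
  · intro d hd
    simp only [Finset.coe_filter, Finset.mem_finsuppAntidiag, Set.mem_ofPred_eq] at hd
    obtain ⟨⟨-, hsupp⟩, -⟩ := hd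
    ext i
    by_cases hiU : i ∈ U
    · have : i ∉ V := fun h => Finset.disjoint_left.1 hUV hiU h
      simp [hiU, this]
    · by_cases hiV : i ∈ V
      · simp [hiU, hiV]
      · have : d i = 0 := Finsupp.notMem_support_iff.1 fun h => by
          rcases Finset.mem_union.1 (hsupp h) with h | h <;> contradiction
        simp [hiU, hiV, this]
  · rintro ⟨⟨m, n⟩, x, y⟩ hz
    simp only [Finset.coe_sigma, Set.mem_sigma_iff, Finset.mem_coe,
      Finset.HasAntidiagonal.mem_antidiagonal, Finset.mem_product, Finset.mem_filter,
      Finset.mem_finsuppAntidiag] at hz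
    obtain ⟨hmn, ⟨⟨hxs, hx⟩, hpx⟩, ⟨hys, hy⟩, hqy⟩ := hz
    obtain ⟨hU, hV⟩ := key x y hx hy
    have e1 : U.sum (x + y) = m := (Finset.sum_congr rfl hU).trans hxs
    have e2 : V.sum (x + y) = n := (Finset.sum_congr rfl hV).trans hys
    have e3 : (x + y).filter (· ∈ U) = x := by
      ext i
      by_cases hi : i ∈ U
      · rw [Finsupp.filter_apply_pos _ _ hi, hU i hi]
      · rw [Finsupp.filter_apply_neg _ _ hi]
        exact (Finsupp.notMem_support_iff.1 fun h => hi (hx h)).symm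
    have e4 : (x + y).filter (· ∈ V) = y := by
      ext i
      by_cases hi : i ∈ V
      · rw [Finsupp.filter_apply_pos _ _ hi, hV i hi]
      · rw [Finsupp.filter_apply_neg _ _ hi]
        exact (Finsupp.notMem_support_iff.1 fun h => hi (hy h)).symm
    simp only [e1, e2, e3, e4]

lemma countSeries_le {V : Finset σ} {e : σ →₀ ℕ} (he : e.support ⊆ V) :
    countSeries V (fun d => e ≤ d) = PowerSeries.X ^ V.sum e * countSeries V fun _ => True := by
  classical
  ext j
  rw [PowerSeries.coeff_X_pow_mul']
  simp only [countSeries, PowerSeries.coeff_mk]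
  split_ifs with hj
  · norm_cast
    refine Finset.card_nbij' (fun d => d - e) (fun d => d + e) ?_ ?_ ?_ ?_
    · intro d hd
      simp only [Finset.coe_filter, Finset.mem_finsuppAntidiag, Set.mem_ofPred_eq, and_true]
        at hd ⊢
      obtain ⟨⟨hs, hsupp⟩, hle⟩ := hd
      refine ⟨?_, ?_⟩
      · have : V.sum (d - e) + V.sum e = j := by
          rw [← Finset.sum_add_distrib, ← hs]
          refine Finset.sum_congr rfl fun i _ => ?_
          have := hle i
          simp only [Finsupp.tsub_apply]
          omega
        omega
      · exact (Finsupp.support_tsub).trans hsupp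
    · intro d hd
      simp only [Finset.coe_filter, Finset.mem_finsuppAntidiag, Set.mem_ofPred_eq, and_true]
        at hd ⊢
      obtain ⟨hs, hsupp⟩ := hd
      refine ⟨⟨?_, ?_⟩, le_add_self⟩
      · have : V.sum (d + e) = V.sum d + V.sum e := by
          rw [← Finset.sum_add_distrib]; rfl
        omega
      · exact Finsupp.support_add.trans (Finset.union_subset hsupp he)
    · intro d hd
      simp only [Finset.coe_filter, Set.mem_ofPred_eq] at hd
      exact tsub_add_cancel_of_le hd.2
    · intro d _
      exact add_tsub_cancel_right d e
  · rw [Nat.cast_eq_zero, Finset.card_eq_zero]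
    refine Finset.eq_empty_of_forall_notMem fun d hd => ?_
    simp only [Finset.mem_filter, Finset.mem_finsuppAntidiag] at hd
    exact hj (hd.1.1 ▸ Finset.sum_le_sum fun i _ => hd.2 i)

lemma one_sub_X_pow_card_mul_countSeries_true (U : Finset σ) :
    (1 - PowerSeries.X) ^ U.card * countSeries U (fun _ => True) = 1 := by
  classical
  induction U using Finset.induction_on with
  | empty =>
    ext j
    rcases j with _ | j <;> simp [countSeries, PowerSeries.coeff_one]
  | insert x U hx ih =>
    have hsingle : countSeries {x} (fun _ => True) = PowerSeries.mk 1 := by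
      ext j
      have : (({x} : Finset σ).finsuppAntidiag j) = {Finsupp.single x j} := by
        ext d
        simp only [Finset.mem_finsuppAntidiag, Finset.sum_singleton, Finset.mem_singleton]
        constructor
        · rintro ⟨h1, h2⟩
          rw [← h1]
          exact Finsupp.eq_single_iff.2 ⟨h2, rfl⟩
        · rintro rfl
          exact ⟨by simp, Finsupp.support_single_subset⟩
      simp [countSeries, this]
    have hd : Disjoint {x} U := Finset.disjoint_singleton_left.2 hx
    have := countSeries_union hd (determinedOn_true {x}) (determinedOn_true U)
    simp only [and_self] at this
    rw [Finset.card_insert_of_notMem hx, Finset.insert_eq, this, hsingle, pow_succ]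
    calc _ = (PowerSeries.mk 1 * (1 - PowerSeries.X)) *
          ((1 - PowerSeries.X) ^ U.card * countSeries U fun _ => True) := by ring
      _ = 1 := by rw [ih, PowerSeries.mk_one_mul_one_sub_eq_one, one_mul]

/-- The series `countSeries U p` divided by its value for the always-true predicate. -/
noncomputable def normSeries (U : Finset σ) (p : (σ →₀ ℕ) → Prop) : PowerSeries ℤ :=
  (1 - PowerSeries.X) ^ U.card * countSeries U p

lemma normSeries_true (U : Finset σ) : normSeries U (fun _ => True) = 1 :=
  one_sub_X_pow_card_mul_countSeries_true U

lemma normSeries_congr {U : Finset σ} {p q : (σ →₀ ℕ) → Prop}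
    (h : ∀ d : σ →₀ ℕ, d.support ⊆ U → (p d ↔ q d)) : normSeries U p = normSeries U q := by
  rw [normSeries, normSeries, countSeries_congr h]

lemma normSeries_union {U V : Finset σ} (hUV : Disjoint U V) {p q : (σ →₀ ℕ) → Prop}
    (hp : DeterminedOn U p) (hq : DeterminedOn V q) :
    normSeries (U ∪ V) (fun d => p d ∧ q d) = normSeries U p * normSeries V q := by
  rw [normSeries, countSeries_union hUV hp hq, Finset.card_union_of_disjoint hUV, normSeries,
    normSeries]
  ring

lemma normSeries_of_subset {U V : Finset σ} (hUV : U ⊆ V) {p : (σ →₀ ℕ) → Prop}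
    (hp : DeterminedOn U p) : normSeries V p = normSeries U p := by
  have h := normSeries_union (V := V \ U) Finset.disjoint_sdiff hp (determinedOn_true _)
  rw [Finset.union_sdiff_of_subset hUV, normSeries_true, mul_one] at h
  simpa only [and_true] using h

lemma normSeries_le {V : Finset σ} {e : σ →₀ ℕ} (he : e.support ⊆ V) :
    normSeries V (fun d => e ≤ d) = PowerSeries.X ^ V.sum e := by
  rw [normSeries, countSeries_le he, mul_left_comm, one_sub_X_pow_card_mul_countSeries_true,
    mul_one]

lemma normSeries_not (U : Finset σ) (p : (σ →₀ ℕ) → Prop) :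
    normSeries U (fun d => ¬ p d) = 1 - normSeries U p := by
  rw [← normSeries_true U, normSeries, normSeries, normSeries, countSeries_not, mul_sub]

/-- Splitting according to divisibility by a monomial in fresh variables. -/
lemma normSeries_split {U V : Finset σ} (hUV : Disjoint U V) {e : σ →₀ ℕ} (he : e.support ⊆ V)
    {p q : (σ →₀ ℕ) → Prop} (hp : DeterminedOn U p) (hq : DeterminedOn U q) :
    normSeries (U ∪ V) (fun d => (p d ∧ ¬ e ≤ d) ∨ (q d ∧ e ≤ d)) =
      normSeries U p * (1 - PowerSeries.X ^ V.sum e) +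
        normSeries U q * PowerSeries.X ^ V.sum e := by
  have hle : DeterminedOn V fun d : σ →₀ ℕ => e ≤ d := by
    have aux : ∀ d d' : σ →₀ ℕ, (∀ x ∈ V, d x = d' x) → e ≤ d → e ≤ d' := by
      intro d d' h hed x
      by_cases hx : x ∈ V
      · exact h x hx ▸ hed x
      · rw [Finsupp.notMem_support_iff.1 fun h => hx (he h)]
        exact Nat.zero_le _
    exact fun d d' h => ⟨aux d d' h, aux d' d fun x hx => (h x hx).symm⟩
  rw [← normSeries_le he, ← normSeries_not, ← normSeries_union hUV hp hle.not,
    ← normSeries_union hUV hq hle, normSeries, normSeries, normSeries, ← mul_add,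
    countSeries_or]
  exact fun d h h' => h.2 h'.2

end Counting

section Patterns

variable {c : ℕ}

/-- The exponent vector with entries `v` in column `p` and zero elsewhere. -/
noncomputable def columnExponent (v : Fin c → ℕ) (p : ℕ) : Fin c × ℕ →₀ ℕ :=
  Finsupp.onFinset (Finset.univ ×ˢ {p}) (fun x => if x.2 = p then v x.1 else 0) (by simp)

lemma columnExponent_apply (v : Fin c → ℕ) (p : ℕ) (x : Fin c × ℕ) :
    columnExponent v p x = if x.2 = p then v x.1 else 0 := rfl

lemma support_columnExponent_subset (v : Fin c → ℕ) (p : ℕ) :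
    (columnExponent v p).support ⊆ Finset.univ ×ˢ {p} :=
  Finsupp.support_onFinset_subset

lemma sum_columnExponent (v : Fin c → ℕ) (p : ℕ) :
    (Finset.univ ×ˢ {p}).sum (columnExponent v p) = ∑ i, v i := by
  simp [columnExponent_apply]

lemma columnExponent_le_iff {v : Fin c → ℕ} {p : ℕ} {d : Fin c × ℕ →₀ ℕ} :
    columnExponent v p ≤ d ↔ ∀ i, v i ≤ d (i, p) := by
  constructor
  · intro h i
    simpa [columnExponent_apply] using h (i, p)
  · rintro h ⟨i, j⟩
    rw [columnExponent_apply]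
    split_ifs with hj
    · obtain rfl : j = p := hj
      exact h i
    · exact Nat.zero_le _

/-- The variables in columns `1, …, n`. -/
def columnBlock (c n : ℕ) : Finset (Fin c × ℕ) := Finset.univ ×ˢ Finset.Icc 1 n

lemma mem_columnBlock {n : ℕ} {x : Fin c × ℕ} : x ∈ columnBlock c n ↔ 1 ≤ x.2 ∧ x.2 ≤ n := by
  simp [columnBlock]

lemma card_columnBlock (c n : ℕ) : (columnBlock c n).card = c * n := by
  simp [columnBlock]

lemma columnBlock_mono {m n : ℕ} (h : m ≤ n) : columnBlock c m ⊆ columnBlock c n :=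
  fun _ hx => mem_columnBlock.2 ((mem_columnBlock.1 hx).imp_right fun h' => h'.trans h)

lemma columnBlock_succ (c n : ℕ) :
    columnBlock c (n + 1) = columnBlock c n ∪ Finset.univ ×ˢ {n + 1} := by
  ext x
  simp only [mem_columnBlock, Finset.mem_union, Finset.mem_product, Finset.mem_univ, true_and,
    Finset.mem_singleton]
  omega

lemma disjoint_columnBlock (c n : ℕ) :
    Disjoint (columnBlock c n) (Finset.univ ×ˢ {n + 1}) := by
  refine Finset.disjoint_left.2 fun x hx hx' => ?_
  simp only [mem_columnBlock, Finset.mem_product, Finset.mem_univ, true_and,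
    Finset.mem_singleton] at hx hx'
  omega

/-- The exponent vector `d` dominates a strictly increasing shift of the first `s` columns
`m 0, …, m (s - 1)`, originally at positions `ν 1, …, ν s`, the last one moving to a position
at most `n`. -/
def ContainsPattern (ν : ℕ → ℕ) (m : ℕ → Fin c → ℕ) (s n : ℕ) (d : Fin c × ℕ →₀ ℕ) : Prop :=
  ∃ π : ℕ → ℕ, StrictMono π ∧ π (ν s) ≤ n ∧ ∀ k < s, ∀ i, m k i ≤ d (i, π (ν (k + 1)))

variable {ν : ℕ → ℕ} {m : ℕ → Fin c → ℕ}

lemma containsPattern_zero (h0 : ν 0 = 0) (n : ℕ) (d : Fin c × ℕ →₀ ℕ) :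
    ContainsPattern ν m 0 n d :=
  ⟨id, strictMono_id, by simp [h0], by simp⟩

lemma ContainsPattern.mono {s n n' : ℕ} {d : Fin c × ℕ →₀ ℕ} (h : ContainsPattern ν m s n d)
    (hn : n ≤ n') : ContainsPattern ν m s n' d :=
  let ⟨π, hπ, hle, hd⟩ := h
  ⟨π, hπ, hle.trans hn, hd⟩

lemma not_containsPattern_of_lt {s n : ℕ} (hn : n < ν s) (d : Fin c × ℕ →₀ ℕ) :
    ¬ ContainsPattern ν m s n d :=
  fun ⟨_, hπ, hle, _⟩ => absurd (hn.trans_le hπ.le_apply) hle.not_gt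

lemma determinedOn_containsPattern (hν : StrictMono ν) (s n : ℕ) :
    DeterminedOn (columnBlock c n) (ContainsPattern ν m s n) := by
  have aux : ∀ d d' : Fin c × ℕ →₀ ℕ, (∀ x ∈ columnBlock c n, d x = d' x) →
      ContainsPattern ν m s n d → ContainsPattern ν m s n d' := by
    rintro d d' h ⟨π, hπ, hle, hd⟩
    refine ⟨π, hπ, hle, fun k hk i => ?_⟩
    rw [← h]
    · exact hd k hk i
    · refine mem_columnBlock.2 ⟨?_, ?_⟩
      · exact (Nat.succ_pos k).trans_le (hν.le_apply.trans hπ.le_apply)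
      · exact (hπ.monotone (hν.monotone hk)).trans hle
  exact fun d d' h => ⟨aux d d' h, aux d' d fun x hx => (h x hx).symm⟩

lemma ContainsPattern.pred (hν : StrictMono ν) {s n : ℕ} {d : Fin c × ℕ →₀ ℕ}
    (h : ContainsPattern ν m (s + 1) n d) :
    ContainsPattern ν m s (n - (ν (s + 1) - ν s)) d := by
  obtain ⟨π, hπ, hle, hd⟩ := h
  refine ⟨π, hπ, ?_, fun k hk => hd k (hk.trans s.lt_succ_self)⟩
  have hlt : ν s < ν (s + 1) := hν s.lt_succ_self
  have h1 := hπ.add_le_nat (ν (s + 1) - ν s) (ν s)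
  rw [Nat.sub_add_cancel hlt.le] at h1
  omega

lemma ContainsPattern.extend (hν : StrictMono ν) {s n : ℕ} {d : Fin c × ℕ →₀ ℕ}
    (hn : ν (s + 1) ≤ n) (h : ContainsPattern ν m s (n - (ν (s + 1) - ν s)) d)
    (hd : ∀ i, m s i ≤ d (i, n)) : ContainsPattern ν m (s + 1) n d := by
  obtain ⟨π, hπ, hle, hd'⟩ := h
  have hlt : ν s < ν (s + 1) := hν s.lt_succ_self
  set ρ : ℕ → ℕ := fun x => if x ≤ ν s then π x else x + n - ν (s + 1) with hρ
  have hρlast : ρ (ν (s + 1)) = n := by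
    simp only [hρ, if_neg hlt.not_ge]
    omega
  refine ⟨ρ, fun x y hxy => ?_, hρlast.le, fun k hk i => ?_⟩
  · simp only [hρ]
    split_ifs with hx hy hy
    · exact hπ hxy
    · have := hπ.monotone hx
      omega
    · omega
    · omega
  · rcases Nat.lt_succ_iff_lt_or_eq.1 hk with hk | rfl
    · have : ρ (ν (k + 1)) = π (ν (k + 1)) := if_pos (hν.monotone hk)
      rw [this]
      exact hd' k hk i
    · rw [hρlast]
      exact hd i

lemma containsPattern_succ_succ (hν : StrictMono ν) {s n : ℕ} {d : Fin c × ℕ →₀ ℕ}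
    (hn : ν (s + 1) ≤ n + 1) :
    ContainsPattern ν m (s + 1) (n + 1) d ↔ ContainsPattern ν m (s + 1) n d ∨
      (ContainsPattern ν m s (n + 1 - (ν (s + 1) - ν s)) d ∧
        columnExponent (m s) (n + 1) ≤ d) := by
  rw [columnExponent_le_iff]
  constructor
  · intro h
    by_cases h' : ContainsPattern ν m (s + 1) n d
    · exact Or.inl h'
    · refine Or.inr ⟨h.pred hν, ?_⟩
      obtain ⟨π, hπ, hle, hd⟩ := h
      have : π (ν (s + 1)) = n + 1 := by
        by_contra hne
        exact h' ⟨π, hπ, by omega, hd⟩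
      exact this ▸ hd s s.lt_succ_self
  · rintro (h | ⟨h, hd⟩)
    · exact h.mono n.le_succ
    · exact h.extend hν hn hd

lemma normSeries_containsPattern_succ (hν : StrictMono ν) {s n : ℕ} (hn : ν (s + 1) ≤ n + 1) :
    normSeries (columnBlock c (n + 1)) (fun d => ¬ ContainsPattern ν m (s + 1) (n + 1) d) =
      normSeries (columnBlock c n) (fun d => ¬ ContainsPattern ν m (s + 1) n d) *
          (1 - PowerSeries.X ^ ∑ i, m s i) +
        normSeries (columnBlock c (n + 1 - (ν (s + 1) - ν s)))
            (fun d => ¬ ContainsPattern ν m s (n + 1 - (ν (s + 1) - ν s)) d) *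
          PowerSeries.X ^ ∑ i, m s i := by
  have hlt : ν s < ν (s + 1) := hν s.lt_succ_self
  have hsub : columnBlock c (n + 1 - (ν (s + 1) - ν s)) ⊆ columnBlock c n :=
    columnBlock_mono (by omega)
  have hdet := (determinedOn_containsPattern (m := m) hν s (n + 1 - (ν (s + 1) - ν s))).not
  rw [← normSeries_of_subset hsub hdet, ← sum_columnExponent (m s) (n + 1),
    ← normSeries_split (disjoint_columnBlock c n) (support_columnExponent_subset (m s) (n + 1))
      (determinedOn_containsPattern hν (s + 1) n).not (hdet.mono hsub), columnBlock_succ]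
  refine normSeries_congr fun d _ => ?_
  rw [containsPattern_succ_succ hν hn]
  have himp : ContainsPattern ν m (s + 1) n d →
      ContainsPattern ν m s (n + 1 - (ν (s + 1) - ν s)) d :=
    fun h => (h.pred hν).mono (by omega)
  tauto

/-- A `q`-analogue of the complete homogeneous symmetric polynomial of degree `N` evaluated at
`b 0, …, b (s - 1)`. -/
noncomputable def qHomogeneous (b : ℕ → ℕ) : ℕ → ℕ → Polynomial ℤ
  | _, 0 => 1
  | 0, _ + 1 => 0
  | s + 1, N + 1 =>
    (∑ i ∈ Finset.range (b s), Polynomial.X ^ i) * qHomogeneous b (s + 1) N +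
      Polynomial.X ^ b s * qHomogeneous b s (N + 1)

lemma normSeries_containsPattern (hν : StrictMono ν) (h0 : ν 0 = 0) (s N n : ℕ)
    (hn : n + 1 = N + ν s) :
    normSeries (columnBlock c n) (fun d => ¬ ContainsPattern ν m s n d) =
      (1 - PowerSeries.X) ^ N * (qHomogeneous (fun k => ∑ i, m k i) s N : PowerSeries ℤ) := by
  induction s generalizing N n with
  | zero =>
    obtain ⟨N, rfl⟩ : ∃ M, N = M + 1 := ⟨n, by omega⟩
    simp [containsPattern_zero h0, normSeries, countSeries_false, qHomogeneous]
  | succ s ihs =>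
    have hlt : ν s < ν (s + 1) := hν s.lt_succ_self
    induction N generalizing n with
    | zero =>
      rw [normSeries_congr (q := fun _ => True), normSeries_true]
      · simp [qHomogeneous]
      · exact fun d _ => iff_true_intro (not_containsPattern_of_lt (by omega) d)
    | succ N ihN =>
      obtain ⟨n, rfl⟩ : ∃ n', n = n' + 1 := ⟨n - 1, by omega⟩
      rw [normSeries_containsPattern_succ hν (by omega), ihN n (by omega),
        ihs (N + 1) _ (by omega), qHomogeneous]
      have hgeom := mul_neg_geom_sum (PowerSeries.X : PowerSeries ℤ) (∑ i, m s i)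
      have hcoe : ((∑ i ∈ Finset.range (∑ i, m s i), Polynomial.X ^ i : Polynomial ℤ) :
          PowerSeries ℤ) = ∑ i ∈ Finset.range (∑ i, m s i), PowerSeries.X ^ i := by
        rw [← Polynomial.coeToPowerSeries.ringHom_apply, map_sum]
        simp
      rw [← hgeom]
      push_cast
      rw [hcoe]
      ring

end Patterns

section Growth

lemma eval_one_qHomogeneous_succ_succ (b : ℕ → ℕ) (s N : ℕ) :
    (qHomogeneous b (s + 1) (N + 1)).eval 1 =
      b s * (qHomogeneous b (s + 1) N).eval 1 + (qHomogeneous b s (N + 1)).eval 1 := by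
  simp [qHomogeneous, Polynomial.eval_finsetSum]

lemma eval_one_qHomogeneous_nonneg (b : ℕ → ℕ) (s N : ℕ) :
    0 ≤ (qHomogeneous b s N).eval 1 := by
  induction s generalizing N with
  | zero => cases N <;> simp [qHomogeneous]
  | succ s ihs =>
    induction N with
    | zero => simp [qHomogeneous]
    | succ N ihN =>
      rw [eval_one_qHomogeneous_succ_succ]
      have := ihs (N + 1)
      positivity

lemma pow_le_eval_one_qHomogeneous (b : ℕ → ℕ) {s k : ℕ} (hk : k < s) (N : ℕ) :
    (b k : ℤ) ^ N ≤ (qHomogeneous b s N).eval 1 := by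
  induction s generalizing N with
  | zero => omega
  | succ s ihs =>
    induction N with
    | zero => simp [qHomogeneous]
    | succ N ihN =>
      rw [eval_one_qHomogeneous_succ_succ]
      have h1 := eval_one_qHomogeneous_nonneg b (s + 1) N
      rcases Nat.lt_succ_iff_lt_or_eq.1 hk with hk' | rfl
      · have := ihs hk' (N + 1)
        nlinarith [Int.natCast_nonneg (b s)]
      · have h2 := eval_one_qHomogeneous_nonneg b k (N + 1)
        rw [pow_succ']
        nlinarith [mul_le_mul_of_nonneg_left ihN (Int.natCast_nonneg (b k))]

lemma eval_one_qHomogeneous_le (b : ℕ → ℕ) {M : ℕ} {s : ℕ} (hM : ∀ k < s, b k ≤ M) (N : ℕ) :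
    (qHomogeneous b s N).eval 1 ≤ ((N : ℤ) + 1) ^ s * (M : ℤ) ^ N := by
  induction s generalizing N with
  | zero => cases N <;> simp [qHomogeneous]
  | succ s ihs =>
    induction N with
    | zero => simp [qHomogeneous]
    | succ N ihN =>
      rw [eval_one_qHomogeneous_succ_succ]
      have hb : (b s : ℤ) ≤ M := by exact_mod_cast hM s s.lt_succ_self
      have h1 := ihs (fun k hk => hM k (hk.trans s.lt_succ_self)) (N + 1)
      have h2 : (b s : ℤ) * (qHomogeneous b (s + 1) N).eval 1 ≤
          M * (((N : ℤ) + 1) ^ (s + 1) * (M : ℤ) ^ N) :=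
        mul_le_mul hb ihN (eval_one_qHomogeneous_nonneg b _ _) (Int.natCast_nonneg M)
      have h3 : ((N : ℤ) + 1) ^ s ≤ ((N : ℤ) + 1 + 1) ^ s := by gcongr; omega
      push_cast at h1 ⊢
      calc _ ≤ M * (((N : ℤ) + 1) ^ (s + 1) * (M : ℤ) ^ N) +
            ((N : ℤ) + 1 + 1) ^ s * (M : ℤ) ^ (N + 1) := add_le_add h2 h1
        _ = (((N : ℤ) + 1) ^ s * (N + 1) + ((N : ℤ) + 1 + 1) ^ s) * (M : ℤ) ^ (N + 1) := by ring
        _ ≤ (((N : ℤ) + 1 + 1) ^ s * (N + 1) + ((N : ℤ) + 1 + 1) ^ s) * (M : ℤ) ^ (N + 1) := by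
          gcongr
        _ = _ := by ring

open Filter in
lemma tendsto_rpow_one_div_of_bounds {u : ℕ → ℝ} {M : ℝ} (hM : 1 ≤ M) (r k : ℕ)
    (hlow : ∀ᶠ n in atTop, M ^ (n - k) ≤ u n)
    (hup : ∀ᶠ n : ℕ in atTop, u n ≤ ((n : ℝ) + 1) ^ r * M ^ n) :
    Tendsto (fun n : ℕ => u n ^ (1 / (n : ℝ))) atTop (nhds M) := by
  have hM0 : 0 < M := one_pos.trans_le hM
  have hL : Tendsto (fun n : ℕ => M ^ (1 - (k : ℝ) / (n : ℝ))) atTop (nhds M) := by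
    have h1 : Tendsto (fun n : ℕ => 1 - (k : ℝ) / (n : ℝ)) atTop (nhds (1 - 0)) :=
      tendsto_const_nhds.sub (tendsto_const_div_atTop_nhds_zero_nat _)
    have h2 := (Real.continuousAt_const_rpow hM0.ne').tendsto.comp h1
    rw [sub_zero, Real.rpow_one] at h2
    exact h2
  have hU : Tendsto (fun n : ℕ => ((n : ℝ) + 1) ^ ((r : ℝ) / (n : ℝ)) * M) atTop (nhds M) := by
    have h1 := (tendsto_rpow_div_mul_add r 1 (-1) one_ne_zero.symm).comp
      (tendsto_atTop_add_const_right atTop (1 : ℝ) tendsto_natCast_atTop_atTop)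
    have h2 := h1.mul_const M
    rw [one_mul] at h2
    refine h2.congr fun n => ?_
    simp
  refine tendsto_of_tendsto_of_tendsto_of_le_of_le' hL hU ?_ ?_
  · filter_upwards [hlow, eventually_ge_atTop (k + 1)] with n hn hk
    have hn0 : (n : ℝ) ≠ 0 := by
      have : n ≠ 0 := by omega
      exact_mod_cast this
    calc M ^ (1 - (k : ℝ) / (n : ℝ)) = (M ^ (n - k)) ^ (1 / (n : ℝ)) := by
          rw [← Real.rpow_natCast, ← Real.rpow_mul hM0.le, Nat.cast_sub (by omega)]
          congr 1
          field_simp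
      _ ≤ _ := Real.rpow_le_rpow (by positivity) hn (by positivity)
  · filter_upwards [hlow, hup, eventually_ge_atTop 1] with n hl hn hk
    have hn0 : (n : ℝ) ≠ 0 := by
      have : n ≠ 0 := by omega
      exact_mod_cast this
    calc u n ^ (1 / (n : ℝ)) ≤ (((n : ℝ) + 1) ^ r * M ^ n) ^ (1 / (n : ℝ)) :=
          Real.rpow_le_rpow ((by positivity : (0 : ℝ) ≤ M ^ (n - k)).trans hl) hn (by positivity)
      _ = _ := by
          rw [Real.mul_rpow (by positivity) (by positivity), ← Real.rpow_natCast,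
            ← Real.rpow_natCast, ← Real.rpow_mul (by positivity), ← Real.rpow_mul hM0.le,
            mul_one_div, mul_one_div, div_self hn0, Real.rpow_one]

end Growth

section Hilbert

variable (K : Type*) [Field K] {c : ℕ}

lemma injective_columnInclusion (c n : ℕ) :
    Function.Injective fun p : Fin c × ColIdx n => (p.1, p.2.1) :=
  fun _ _ h => Prod.ext (Prod.ext_iff.1 h).1 (Subtype.ext (Prod.ext_iff.1 h).2)

lemma support_subset_columnBlock {n : ℕ} {f : MvPolynomial (Fin c × ColIdx n) K}
    {d : Fin c × ℕ →₀ ℕ} (hd : d ∈ (toBigC K c n f).support) : d.support ⊆ columnBlock c n := by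
  classical
  rw [toBigC, support_rename_of_injective (injective_columnInclusion c n),
    Finset.mem_image] at hd
  obtain ⟨e, -, rfl⟩ := hd
  intro x hx
  obtain ⟨y, -, rfl⟩ := Finset.mem_image.1 (Finsupp.mapDomain_support hx)
  exact mem_columnBlock.2 (Finset.mem_Icc.1 y.2.2)

lemma isHomogeneous_toBigC_iff {n j : ℕ} {f : MvPolynomial (Fin c × ColIdx n) K} :
    (toBigC K c n f).IsHomogeneous j ↔ f.IsHomogeneous j :=
  IsHomogeneous.rename_isHomogeneous_iff (injective_columnInclusion c n)

lemma mem_finsuppAntidiag_of_mem_support {n j : ℕ} {f : MvPolynomial (Fin c × ColIdx n) K}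
    (hf : f.IsHomogeneous j) {d : Fin c × ℕ →₀ ℕ} (hd : d ∈ (toBigC K c n f).support) :
    d ∈ (columnBlock c n).finsuppAntidiag j := by
  have hsub := support_subset_columnBlock K hd
  refine Finset.mem_finsuppAntidiag.2 ⟨?_, hsub⟩
  have h := (isHomogeneous_toBigC_iff K).2 hf (mem_support_iff.1 hd)
  rw [Pi.one_def, ← Finsupp.degree_eq_weight_one, Finsupp.degree_apply] at h
  rw [← h]
  exact (Finset.sum_subset hsub fun x _ hx => Finsupp.notMem_support_iff.1 hx).symm

lemma exists_toBigC_eq_sum_monomial {n j : ℕ} {S : Finset (Fin c × ℕ →₀ ℕ)}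
    (hS : S ⊆ (columnBlock c n).finsuppAntidiag j) (g : (Fin c × ℕ →₀ ℕ) → K) :
    ∃ f : MvPolynomial (Fin c × ColIdx n) K, f.IsHomogeneous j ∧
      toBigC K c n f = ∑ d ∈ S, monomial d (g d) := by
  have hvars : ((∑ d ∈ S, monomial d (g d)).vars : Set (Fin c × ℕ)) ⊆
      Set.range fun p : Fin c × ColIdx n => (p.1, p.2.1) := by
    classical
    intro x hx
    obtain ⟨d, hd, hxd⟩ := Finset.mem_biUnion.1 (vars_sum_subset _ _ hx)
    have hx' : x ∈ columnBlock c n := by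
      by_cases hg : g d = 0
      · simp [hg] at hxd
      · rw [vars_monomial hg] at hxd
        exact (Finset.mem_finsuppAntidiag.1 (hS hd)).2 hxd
    exact ⟨(x.1, ⟨x.2, Finset.mem_Icc.2 (mem_columnBlock.1 hx')⟩), rfl⟩
  obtain ⟨f, hf⟩ := exists_rename_eq_of_vars_subset_range _ _
    (injective_columnInclusion c n) hvars
  refine ⟨f, ?_, hf⟩
  rw [← isHomogeneous_toBigC_iff]
  change (rename _ f).IsHomogeneous j
  rw [hf]
  refine IsHomogeneous.sum _ _ _ fun d hd => isHomogeneous_monomial _ ?_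
  obtain ⟨h1, h2⟩ := Finset.mem_finsuppAntidiag.1 (hS hd)
  rw [← h1, Finsupp.degree_apply]
  exact Finset.sum_subset h2 fun x _ hx => Finsupp.notMem_support_iff.1 hx

/-- The Hilbert function of the restriction of a monomial ideal counts the monomials outside
the ideal. -/
lemma hseries_restrC {I : Ideal (MvPolynomial (Fin c × ℕ) K)} {p : (Fin c × ℕ →₀ ℕ) → Prop}
    (hI : ∀ f, f ∈ I ↔ ∀ d ∈ f.support, p d) (n : ℕ) :
    hseries K (restrC K I n) = countSeries (columnBlock c n) fun d => ¬ p d := by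
  classical
  ext j
  simp only [hseries, countSeries, PowerSeries.coeff_mk, Nat.cast_inj]
  set S := ((columnBlock c n).finsuppAntidiag j).filter fun d => ¬ p d with hS
  let φ : homogeneousSubmodule (Fin c × ColIdx n) K j →ₗ[K] (S → K) :=
    LinearMap.pi fun d => lcoeff K d.1 ∘ₗ (toBigC K c n).toLinearMap ∘ₗ
      (homogeneousSubmodule (Fin c × ColIdx n) K j).subtype
  have hφ : ∀ f d, φ f d = coeff d.1 (toBigC K c n f.1) := fun _ _ => rfl
  have hsurj : Function.Surjective φ := by
    intro g
    obtain ⟨f, hf, hfg⟩ := exists_toBigC_eq_sum_monomial K (n := n) (S := S)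
      (Finset.filter_subset _ _) fun d => if h : d ∈ S then g ⟨d, h⟩ else 0
    refine ⟨⟨f, (mem_homogeneousSubmodule _ _).2 hf⟩, funext fun d => ?_⟩
    rw [hφ, hfg, coeff_sum]
    simp [coeff_monomial]
  have hker : Submodule.comap (homogeneousSubmodule (Fin c × ColIdx n) K j).subtype
      (Submodule.restrictScalars K (restrC K I n)) = LinearMap.ker φ := by
    ext f
    rw [LinearMap.mem_ker, Submodule.mem_comap, Submodule.restrictScalars_mem, restrC,
      Ideal.mem_comap, hI, funext_iff]
    constructor
    · intro h d
      rw [hφ]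
      by_contra hne
      exact (Finset.mem_filter.1 d.2).2 (h d.1 (mem_support_iff.2 hne))
    · intro h d hd
      by_contra hp
      have hdS : d ∈ S := Finset.mem_filter.2
        ⟨mem_finsuppAntidiag_of_mem_support K ((mem_homogeneousSubmodule _ _).1 f.2) hd, hp⟩
      exact mem_support_iff.1 hd (h ⟨d, hdS⟩)
  rw [hilbF, hker, (φ.quotKerEquivOfSurjective hsurj).finrank_eq, Module.finrank_fintype_fun_eq_card,
    Fintype.card_coe, hS]
  congr!

/-- The exponent vector of `orbMonC`. -/
noncomputable def orbExponent (r : ℕ) (μ : ℕ → ℕ) (a : Fin c → ℕ → ℕ) : Fin c × ℕ →₀ ℕ :=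
  ∑ i : Fin c, ∑ j ∈ Finset.Icc 1 (μ (r - 1)), Finsupp.single (i, j) (a i j)

lemma orbMonC_eq_monomial (r : ℕ) (μ : ℕ → ℕ) (a : Fin c → ℕ → ℕ) :
    orbMonC K c r μ a = monomial (orbExponent r μ a) 1 := by
  simp_rw [orbMonC, orbExponent, monomial_sum_one, X_pow_eq_monomial]

lemma orbExponent_apply (r : ℕ) (μ : ℕ → ℕ) (a : Fin c → ℕ → ℕ) (i : Fin c) (j : ℕ) :
    orbExponent r μ a (i, j) = if j ∈ Finset.Icc 1 (μ (r - 1)) then a i j else 0 := by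
  classical
  simp only [orbExponent, Finsupp.finsetSum_apply, Finsupp.single_apply, Prod.mk.injEq]
  rw [Finset.sum_eq_single i (by intro k _ hk; simp [hk]) (by simp)]
  simp

lemma mapDomain_le_iff {α β : Type*} {f : α → β} (hf : Function.Injective f) {e : α →₀ ℕ}
    {d : β →₀ ℕ} : e.mapDomain f ≤ d ↔ ∀ x, e x ≤ d (f x) := by
  constructor
  · intro h x
    simpa [Finsupp.mapDomain_apply hf] using h (f x)
  · intro h y
    by_cases hy : y ∈ Set.range f
    · obtain ⟨x, rfl⟩ := hy
      rw [Finsupp.mapDomain_apply hf]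
      exact h x
    · rw [Finsupp.mapDomain_of_notMem_range _ _ hy]
      exact Nat.zero_le _

lemma mem_orbitIdealC_iff {m : Fin c × ℕ →₀ ℕ} {f : MvPolynomial (Fin c × ℕ) K} :
    f ∈ orbitIdealC K (monomial m (1 : K)) ↔
      ∀ d ∈ f.support, ∃ π : ℕ → ℕ, StrictMono π ∧ ∀ i j, m (i, j) ≤ d (i, π j) := by
  have hset : {q : MvPolynomial (Fin c × ℕ) K | ∃ π : ℕ → ℕ, StrictMono π ∧
      q = rename (fun p => (p.1, π p.2)) (monomial m 1)} = (fun s => monomial s 1) ''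
        {e | ∃ π : ℕ → ℕ, StrictMono π ∧
          e = m.mapDomain fun p : Fin c × ℕ => (p.1, π p.2)} := by
    ext q
    constructor
    · rintro ⟨π, hπ, rfl⟩
      exact ⟨_, ⟨π, hπ, rfl⟩, (rename_monomial _ _ _).symm⟩
    · rintro ⟨_, ⟨π, hπ, rfl⟩, rfl⟩
      exact ⟨π, hπ, (rename_monomial _ _ _).symm⟩
  have hinj : ∀ π : ℕ → ℕ, StrictMono π →
      Function.Injective fun p : Fin c × ℕ => (p.1, π p.2) :=
    fun π hπ _ _ h => Prod.ext (Prod.ext_iff.1 h).1 (hπ.injective (Prod.ext_iff.1 h).2)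
  rw [orbitIdealC, hset, mem_ideal_span_monomial_image]
  refine forall₂_congr fun d _ => ⟨?_, ?_⟩
  · rintro ⟨_, ⟨π, hπ, rfl⟩, hle⟩
    exact ⟨π, hπ, fun i j => (mapDomain_le_iff (hinj π hπ)).1 hle (i, j)⟩
  · rintro ⟨π, hπ, h⟩
    exact ⟨_, ⟨π, hπ, rfl⟩, (mapDomain_le_iff (hinj π hπ)).2 fun x => h x.1 x.2⟩

/-- The positions `0, μ 0, …, μ (r - 1)`, continued with step one. -/
def columnPositions (μ : ℕ → ℕ) (r : ℕ) : ℕ → ℕ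
  | 0 => 0
  | s + 1 => if s < r then μ s else columnPositions μ r s + 1

lemma strictMono_columnPositions {μ : ℕ → ℕ} {r : ℕ} (hμ1 : 1 ≤ μ 0)
    (hμ : ∀ j, j + 1 < r → μ j < μ (j + 1)) : StrictMono (columnPositions μ r) := by
  refine strictMono_nat_of_lt_succ fun s => ?_
  rcases s with _ | s
  · simp only [columnPositions]
    split_ifs <;> omega
  · rw [columnPositions.eq_2 μ r (s + 1)]
    split_ifs with h
    · simpa only [columnPositions, if_pos (show s < r by omega)] using hμ s h
    · exact Nat.lt_succ_self _

lemma columnPositions_succ {μ : ℕ → ℕ} {r k : ℕ} (hk : k < r) :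
    columnPositions μ r (k + 1) = μ k := if_pos hk

lemma exists_shift_iff_containsPattern {r : ℕ} (hr : 1 ≤ r) {μ : ℕ → ℕ} (hμ1 : 1 ≤ μ 0)
    (hμ : ∀ j, j + 1 < r → μ j < μ (j + 1)) {a : Fin c → ℕ → ℕ}
    (hcols : ∀ j : ℕ, (∃ i, a i j ≠ 0) ↔ ∃ k, k < r ∧ j = μ k) {n : ℕ}
    {d : Fin c × ℕ →₀ ℕ} (hd : d.support ⊆ columnBlock c n) :
    (∃ π : ℕ → ℕ, StrictMono π ∧ ∀ i j, orbExponent r μ a (i, j) ≤ d (i, π j)) ↔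
      ContainsPattern (columnPositions μ r) (fun k i => a i (μ k)) r n d := by
  have hν := strictMono_columnPositions hμ1 hμ
  obtain ⟨r, rfl⟩ : ∃ r', r = r' + 1 := ⟨r - 1, by omega⟩
  have hmem : ∀ k < r + 1, μ k ∈ Finset.Icc 1 (μ (r + 1 - 1)) := by
    intro k hk
    have h1 : k + 1 ≤ columnPositions μ (r + 1) (k + 1) := hν.le_apply
    have h2 := hν.monotone (show k + 1 ≤ r + 1 by omega)
    rw [columnPositions_succ hk] at h1 h2
    rw [columnPositions_succ r.lt_succ_self] at h2
    exact Finset.mem_Icc.2 ⟨by omega, h2⟩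
  refine exists_congr fun π => and_congr_right fun hπ => ⟨fun h => ⟨?_, fun k hk i => ?_⟩, ?_⟩
  · rw [columnPositions_succ r.lt_succ_self]
    obtain ⟨i, hi⟩ := (hcols (μ r)).2 ⟨r, r.lt_succ_self, rfl⟩
    have hi' := h i (μ r)
    rw [orbExponent_apply, if_pos (hmem r r.lt_succ_self)] at hi'
    have : (i, π (μ r)) ∈ d.support := Finsupp.mem_support_iff.2 (by omega)
    exact (mem_columnBlock.1 (hd this)).2
  · have hi := h i (μ k)
    rw [orbExponent_apply, if_pos (hmem k hk)] at hi
    rwa [columnPositions_succ hk]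
  · rintro ⟨-, h⟩ i j
    by_cases hj : a i j = 0
    · simp [orbExponent_apply, hj]
    · obtain ⟨k, hk, rfl⟩ := (hcols j).1 ⟨i, hj⟩
      have hk' := h k hk i
      rw [columnPositions_succ hk] at hk'
      rwa [orbExponent_apply, if_pos (hmem k hk)]

/-- The numerator of the Hilbert series is a `q`-analogue of a complete homogeneous symmetric
polynomial in the column sums. -/
lemma eq_qHomogeneous_of_coe_eq (hc : 1 ≤ c) {r : ℕ} (hr : 1 ≤ r) {μ : ℕ → ℕ} (hμ1 : 1 ≤ μ 0)
    (hμ : ∀ j, j + 1 < r → μ j < μ (j + 1)) {a : Fin c → ℕ → ℕ}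
    (hcols : ∀ j : ℕ, (∃ i, a i j ≠ 0) ↔ ∃ k, k < r ∧ j = μ k) {n : ℕ}
    (hn : μ (r - 1) ≤ n + 1) {p : Polynomial ℤ}
    (hp : (p : PowerSeries ℤ) =
      (1 - PowerSeries.X : PowerSeries ℤ) ^ (n * (c - 1) + μ (r - 1) - 1) *
        hseries K (restrC K (orbitIdealC K (orbMonC K c r μ a)) n)) :
    p = qHomogeneous (fun k => ∑ i, a i (μ k)) r (n + 1 - μ (r - 1)) := by
  have hν := strictMono_columnPositions hμ1 hμ
  have hνr : columnPositions μ r r = μ (r - 1) := by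
    obtain ⟨r, rfl⟩ : ∃ r', r = r' + 1 := ⟨r - 1, by omega⟩
    exact columnPositions_succ r.lt_succ_self
  have hpos : 1 ≤ μ (r - 1) := hνr ▸ hr.trans hν.le_apply
  have key := normSeries_containsPattern (m := fun k i => a i (μ k)) hν rfl r
    (n + 1 - μ (r - 1)) n (by omega)
  rw [← normSeries_congr fun d hd =>
      not_congr (exists_shift_iff_containsPattern hr hμ1 hμ hcols hd),
    normSeries, ← hseries_restrC K (fun f => mem_orbitIdealC_iff K), ← orbMonC_eq_monomial,
    card_columnBlock] at key
  have hexp : c * n = n + 1 - μ (r - 1) + (n * (c - 1) + μ (r - 1) - 1) := by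
    obtain ⟨c, rfl⟩ : ∃ c', c = c' + 1 := ⟨c - 1, by omega⟩
    rw [Nat.add_sub_cancel, add_mul, one_mul, mul_comm c n]
    omega
  rw [hexp, pow_add, mul_assoc, ← hp] at key
  have hne : (1 - PowerSeries.X : PowerSeries ℤ) ≠ 0 := by
    intro h
    simpa using congrArg (PowerSeries.coeff 0) h
  exact Polynomial.coe_injective ℤ (mul_left_cancel₀ (pow_ne_zero _ hne) key)

end Hilbert

/-- With `b_j = Σᵢ a_{i,μ_j}`, the sequence `(deg I_n)^{1/n}` converges to
`max{b_1, …, b_r}` as `n → ∞`, where for `n ≥ μ_r - 1` the degree `deg I_n` is the value at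
`t = 1` of the polynomial `(1-t)^{n(c-1)+μ_r-1}·H_{K[X_n]/I_n}(t)`. -/
theorem statement19 (K : Type*) [Field K] (c : ℕ) (hc : 1 ≤ c) (r : ℕ) (hr : 1 ≤ r)
    (μ : ℕ → ℕ) (hμ1 : 1 ≤ μ 0) (hμ : ∀ j, j + 1 < r → μ j < μ (j + 1))
    (a : Fin c → ℕ → ℕ) (hcols : ∀ j : ℕ, (∃ i, a i j ≠ 0) ↔ ∃ k, k < r ∧ j = μ k)
    (b : ℕ → ℕ) (hb : ∀ j, b j = ∑ i : Fin c, a i (μ j))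
    (P : ℕ → Polynomial ℤ)
    (hP : ∀ n, μ (r - 1) ≤ n + 1 →
      (↑(P n) : PowerSeries ℤ) =
        (1 - PowerSeries.X : PowerSeries ℤ) ^ (n * (c - 1) + μ (r - 1) - 1) *
          hseries K (restrC K (orbitIdealC K (orbMonC K c r μ a)) n)) :
    Filter.Tendsto (fun n : ℕ => (((P n).eval 1 : ℤ) : ℝ) ^ (1 / (n : ℝ))) Filter.atTop
      (nhds (((Finset.range r).sup b : ℕ) : ℝ)) := by
  have hbound := fun n hn => eq_qHomogeneous_of_coe_eq K hc hr hμ1 hμ hcols hn (hP n hn)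
  have hb' : (fun k => ∑ i, a i (μ k)) = b := funext fun k => (hb k).symm
  rw [hb'] at hbound
  have hle : ∀ k < r, b k ≤ (Finset.range r).sup b :=
    fun k hk => Finset.le_sup (Finset.mem_range.2 hk)
  have hone : 1 ≤ (Finset.range r).sup b := by
    refine le_trans ?_ (hle 0 hr)
    obtain ⟨i, hi⟩ := (hcols (μ 0)).2 ⟨0, hr, rfl⟩
    rw [hb]
    exact (Nat.one_le_iff_ne_zero.2 hi).trans
      (Finset.single_le_sum (f := fun i => a i (μ 0)) (fun _ _ => Nat.zero_le _)
        (Finset.mem_univ i))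
  obtain ⟨k, hk, hmax⟩ := Finset.exists_mem_eq_sup (Finset.range r)
    (Finset.nonempty_range_iff.2 (by omega)) b
  have hpos : 1 ≤ μ (r - 1) := by
    by_contra h
    have := strictMono_columnPositions hμ1 hμ
    have h1 : r ≤ columnPositions μ r r := this.le_apply
    obtain ⟨r, rfl⟩ : ∃ r', r = r' + 1 := ⟨r - 1, by omega⟩
    rw [columnPositions_succ r.lt_succ_self] at h1
    simp only [Nat.add_sub_cancel] at h
    omega
  refine tendsto_rpow_one_div_of_bounds (by exact_mod_cast hone) r (μ (r - 1) - 1) ?_ ?_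
  · filter_upwards [Filter.eventually_ge_atTop (μ (r - 1))] with n hn
    have h := pow_le_eval_one_qHomogeneous b (Finset.mem_range.1 hk) (n + 1 - μ (r - 1))
    rw [← hbound n (by omega), ← hmax] at h
    rw [show n - (μ (r - 1) - 1) = n + 1 - μ (r - 1) by omega]
    exact_mod_cast h
  · filter_upwards [Filter.eventually_ge_atTop (μ (r - 1))] with n hn
    have h := eval_one_qHomogeneous_le b hle (n + 1 - μ (r - 1))
    rw [← hbound n (by omega)] at h
    have h' : (((P n).eval 1 : ℤ) : ℝ) ≤ (((n + 1 - μ (r - 1) : ℕ) : ℝ) + 1) ^ r *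
        (((Finset.range r).sup b : ℕ) : ℝ) ^ (n + 1 - μ (r - 1)) := by exact_mod_cast h
    have hone' : (1 : ℝ) ≤ (((Finset.range r).sup b : ℕ) : ℝ) := by exact_mod_cast hone
    have hN : n + 1 - μ (r - 1) ≤ n := by omega
    refine h'.trans ?_
    gcongr
end
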